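/- For every integer g ≥ 3, the family 𝒻_g of all finite graphs with girth at least g is not durable: for every infinite graph G of infinite chromatic number, there exists an induced subgraph of G with infinite chromatic number that fails to contain some member of 𝒻_g as an induced subgraph. -/

import Mathlib

open Classical in
/-- Closed neighbourhood ball of radius `r` around `u`. -/
noncomputable def eball {V : Type*} [Fintype V] (G : SimpleGraph V) (u : V) : ℕ → Finset V
  | 0 => {u}
  | r + 1 => (eball G u r).biUnion (fun x => insert x (Finset.univ.filter (fun y => G.Adj x y)))

open Classical in
theorem eball_card {V : Type*} [Fintype V] (G : SimpleGraph V) (u : V) (Δ : ℕ)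
    (h : ∀ x, (Finset.univ.filter (fun y => G.Adj x y)).card ≤ Δ) (r : ℕ) :
    (eball G u r).card ≤ (Δ + 1) ^ r := by
  induction r with
  | zero => simp [eball]
  | succ r ih =>
    rw [eball, pow_succ]
    refine (Finset.card_biUnion_le_card_mul _ _ (Δ + 1) ?_).trans (Nat.mul_le_mul_right _ ih)
    intro x _
    exact (Finset.card_insert_le _ _).trans (Nat.succ_le_succ (h x))

open Classical in
theorem eball_mono {V : Type*} [Fintype V] (G : SimpleGraph V) (u : V) {r s : ℕ} (h : r ≤ s) :
    eball G u r ⊆ eball G u s := by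
  induction s, h using Nat.le_induction with
  | base => exact subset_rfl
  | succ s _ ih =>
    refine ih.trans ?_
    intro x hx
    rw [eball, Finset.mem_biUnion]
    exact ⟨x, hx, by simp⟩

open Classical in
theorem eball_walk {V : Type*} [Fintype V] (G : SimpleGraph V) (u : V) {a b : V}
    (p : G.Walk a b) : ∀ r, a ∈ eball G u r → b ∈ eball G u (r + p.length) := by
  induction p with
  | nil => intro r h; simpa using h
  | @cons x y z hxy p ih =>
    intro r h
    have h1 : y ∈ eball G u (r + 1) := by
      rw [eball, Finset.mem_biUnion]
      exact ⟨x, h, by simp [hxy]⟩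
    have := ih (r + 1) h1
    rw [SimpleGraph.Walk.length_cons]
    convert this using 2
    omega

theorem eball_of_walk {V : Type*} [Fintype V] (G : SimpleGraph V) {u v : V} (g : ℕ)
    (p : G.Walk u v) (h : p.length ≤ g) : v ∈ eball G u g := by
  have := eball_walk G u p 0 (by simp [eball])
  exact eball_mono G u (by omega) this

/-- A walk avoiding the new edge is a walk of the old graph. -/
theorem walk_old {V : Type*} (G : SimpleGraph V) (u v : V) {a b : V}
    (p : (G ⊔ SimpleGraph.edge u v).Walk a b) (h : s(u, v) ∉ p.edges) :
    ∃ q : G.Walk a b, q.length = p.length ∧ q.edges = p.edges := by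
  have hp : ∀ e ∈ p.edges, e ∈ G.edgeSet := by
    intro e he
    have h1 := p.edges_subset_edgeSet he
    induction e with | _ x y =>
    rw [SimpleGraph.mem_edgeSet, SimpleGraph.sup_adj, SimpleGraph.edge_adj] at h1
    rcases h1 with h1 | ⟨⟨rfl, rfl⟩ | ⟨rfl, rfl⟩, _⟩
    · exact h1
    · exact absurd he h
    · rw [Sym2.eq_swap] at he; exact absurd he h
  exact ⟨p.transfer G hp, by simp, by simp⟩

/-- A trail through the new edge splits. -/
theorem walk_split {V : Type*} (G : SimpleGraph V) (u v : V) {a b : V}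
    (p : (G ⊔ SimpleGraph.edge u v).Walk a b) (hn : p.edges.Nodup) (h : s(u, v) ∈ p.edges) :
    ∃ (x y : V) (q₁ : G.Walk a x) (q₂ : G.Walk y b), s(x, y) = s(u, v) ∧
      q₁.length + q₂.length + 1 = p.length := by
  induction p with
  | nil => simp at h
  | @cons x y z hxy p ih =>
    rw [SimpleGraph.Walk.edges_cons, List.nodup_cons] at hn
    by_cases he : s(x, y) = s(u, v)
    · obtain ⟨q, hq, -⟩ := walk_old G u v p (he ▸ hn.1)
      exact ⟨x, y, .nil, q, he, by simp [hq]⟩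
    · rw [SimpleGraph.Walk.edges_cons, List.mem_cons] at h
      have h' : s(u, v) ∈ p.edges := h.resolve_left (fun h => he h.symm)
      obtain ⟨x', y', q₁, q₂, h1, h2⟩ := ih hn.2 h'
      have hG : G.Adj x y := by
        rw [SimpleGraph.sup_adj, SimpleGraph.edge_adj] at hxy
        rcases hxy with h1 | ⟨⟨rfl, rfl⟩ | ⟨rfl, rfl⟩, _⟩
        · exact h1
        · exact absurd rfl he
        · exact absurd Sym2.eq_swap he
      exact ⟨x', y', .cons hG q₁, q₂, h1, by simp; omega⟩

theorem girth_add {V : Type*} [Fintype V] (G : SimpleGraph V) (g : ℕ) (u v : V)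
    (hG : ∀ a (w : G.Walk a a), w.IsCycle → g < w.length) (huv : v ∉ eball G u g) :
    ∀ a (w : (G ⊔ SimpleGraph.edge u v).Walk a a), w.IsCycle → g < w.length := by
  intro a w hw
  by_cases he : s(u, v) ∈ w.edges
  · obtain ⟨x, y, q₁, q₂, h1, h2⟩ := walk_split G u v w hw.edges_nodup he
    by_contra hlt
    have hq : (q₂.append q₁).length ≤ g := by rw [SimpleGraph.Walk.length_append]; omega
    rw [Sym2.eq_iff] at h1
    rcases h1 with ⟨rfl, rfl⟩ | ⟨rfl, rfl⟩
    · exact huv (eball_of_walk G g (q₂.append q₁).reverse (by rw [SimpleGraph.Walk.length_reverse]; exact hq))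
    · exact huv (eball_of_walk G g (q₂.append q₁) hq)
  · have hp : ∀ e ∈ w.edges, e ∈ G.edgeSet := by
      intro e he'
      have h1 := w.edges_subset_edgeSet he'
      induction e with | _ x y =>
      rw [SimpleGraph.mem_edgeSet, SimpleGraph.sup_adj, SimpleGraph.edge_adj] at h1
      rcases h1 with h1 | ⟨⟨rfl, rfl⟩ | ⟨rfl, rfl⟩, _⟩
      · exact h1
      · exact absurd he' he
      · rw [Sym2.eq_swap] at he'; exact absurd he' he
    have := hG a (w.transfer G hp) (hw.transfer hp)
    simpa using this

open Classical in
/-- Proper colourings. -/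
noncomputable def pcol {V : Type*} [Fintype V] (G : SimpleGraph V) (k : ℕ) : Finset (V → Fin k) :=
  Finset.univ.filter (fun c => ∀ a b, G.Adj a b → c a ≠ c b)

open Classical in
/-- Averaging step. -/
theorem good_pair {V : Type*} [Fintype V] (G : SimpleGraph V) (g k D : ℕ) (hk : 0 < k) (hD : 0 < D)
    (hcard : Fintype.card V = 4 * k * D) (S : Finset V) (hS : 2 * k * D ≤ S.card)
    (hball : ∀ u, (eball G u g).card ≤ D) (hN : 0 < (pcol G k).card) :
    ∃ u ∈ S, ∃ v ∈ S, v ∉ eball G u g ∧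
      (pcol G k).card ≤ 8 * k ^ 2 * ((pcol G k).filter (fun c => c u = c v)).card := by
  by_contra hcon
  push Not at hcon
  set A : Finset (V × V) := (S ×ˢ S).filter (fun q => q.2 ∉ eball G q.1 g) with hA
  -- each colouring has many monochromatic allowed pairs
  have h1 : ∀ c ∈ pcol G k, 2 * D * D ≤ (A.filter (fun q => c q.1 = c q.2)).card := by
    intro c _
    have : Nonempty (Fin k) := ⟨⟨0, hk⟩⟩
    obtain ⟨i, -, hi⟩ := Finset.exists_le_card_fiber_of_mul_le_card_of_maps_to
      (s := S) (t := (Finset.univ : Finset (Fin k))) (f := c) (n := 2 * D) (by simp)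
      Finset.univ_nonempty (by rw [Finset.card_univ, Fintype.card_fin]; linarith)
    set T := S.filter (fun x => c x = i) with hT
    have h2 : (T.sigma (fun u => T \ eball G u g)).card ≤
        (A.filter (fun q => c q.1 = c q.2)).card := by
      apply Finset.card_le_card_of_injOn (fun q => (q.1, q.2))
      · rintro ⟨a, b⟩ hq
        simp only [Finset.coe_sigma, Set.mem_sigma_iff, Finset.mem_coe, Finset.mem_sdiff, hT,
          Finset.mem_filter] at hq
        simp only [Finset.coe_filter, Set.mem_ofPred_eq, hA, Finset.mem_filter, Finset.mem_product]
        grind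
      · rintro ⟨a, b⟩ _ ⟨a', b'⟩ _ h
        simpa using h
    refine le_trans ?_ h2
    rw [Finset.card_sigma]
    have h3 : ∀ u ∈ T, D ≤ (T \ eball G u g).card := by
      intro u _
      have := Finset.le_card_sdiff (eball G u g) T
      have := hball u
      omega
    calc 2 * D * D ≤ T.card * D := Nat.mul_le_mul_right _ hi
      _ ≤ _ := by simpa using Finset.card_nsmul_le_sum T _ D h3
  have h4 : (pcol G k).card * (2 * D * D) ≤
      ∑ q ∈ A, ((pcol G k).filter (fun c => c q.1 = c q.2)).card := by
    have := Finset.card_nsmul_le_sum (pcol G k) _ _ h1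
    rw [smul_eq_mul] at this
    refine this.trans (le_of_eq ?_)
    exact Finset.sum_card_bipartiteAbove_eq_sum_card_bipartiteBelow (fun (c : V → Fin k) (q : V × V) => c q.1 = c q.2)
  have hAne : A.Nonempty := by
    rw [Finset.nonempty_iff_ne_empty]
    intro h0
    rw [h0, Finset.sum_empty] at h4
    have : 0 < (pcol G k).card * (2 * D * D) := by positivity
    omega
  have h5 : ∑ q ∈ A, 8 * k ^ 2 * ((pcol G k).filter (fun c => c q.1 = c q.2)).card <
      ∑ q ∈ A, (pcol G k).card := by
    apply Finset.sum_lt_sum_of_nonempty hAne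
    rintro ⟨a, b⟩ hq
    simp only [hA, Finset.mem_filter, Finset.mem_product] at hq
    exact hcon a hq.1.1 b hq.1.2 hq.2
  have h6 : A.card ≤ (4 * k * D) * (4 * k * D) := by
    refine (Finset.card_le_univ A).trans ?_
    rw [Fintype.card_prod, hcard]
  rw [← Finset.mul_sum, Finset.sum_const, smul_eq_mul] at h5
  have h7 := Nat.mul_le_mul_left (8 * k ^ 2) h4
  have h8 := Nat.mul_le_mul_right (pcol G k).card h6
  have h9 : 8 * k ^ 2 * ((pcol G k).card * (2 * D * D)) = 4 * k * D * (4 * k * D) * (pcol G k).card := by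
    ring
  omega

open Classical in
theorem erdos_iter (g k M : ℕ) (hk : 0 < k) {V : Type*} [Fintype V]
    (hcard : Fintype.card V = 4 * k * (4 * M + 1) ^ g) (hM : 0 < M)
    (hcol : ∀ G : SimpleGraph V, (∀ a (w : G.Walk a a), w.IsCycle → g < w.length) →
      0 < (pcol G k).card) (i : ℕ) (hi : i ≤ M * Fintype.card V) :
    ∃ (G : SimpleGraph V) (d : V → ℕ), (∀ a (w : G.Walk a a), w.IsCycle → g < w.length) ∧
      (∀ x, (Finset.univ.filter (fun y => G.Adj x y)).card ≤ d x) ∧ (∀ x, d x ≤ 4 * M) ∧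
      ∑ x, d x = 2 * i ∧
      ((pcol G k).card : ℝ) ≤ (1 - 1 / (8 * k ^ 2)) ^ i * k ^ (Fintype.card V) := by
  induction i with
  | zero =>
    refine ⟨⊥, 0, ?_, by simp, by simp, by simp, ?_⟩
    · intro a w hw
      exact absurd hw (SimpleGraph.isAcyclic_bot w)
    · have : (pcol (⊥ : SimpleGraph V) k).card ≤ k ^ Fintype.card V := by
        refine (Finset.card_le_univ _).trans ?_
        simp
      simpa using (by exact_mod_cast this : ((pcol (⊥ : SimpleGraph V) k).card : ℝ) ≤ (k : ℝ) ^ Fintype.card V)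
  | succ i ih =>
    obtain ⟨G, d, hG, hd, hdM, hsum, hN⟩ := ih (by omega)
    set D := (4 * M + 1) ^ g with hD
    set S : Finset V := Finset.univ.filter (fun x => d x < 4 * M) with hSdef
    have hS : 2 * k * D ≤ S.card := by
      have h1 : (Finset.univ.filter (fun x => ¬ d x < 4 * M)).card * (4 * M) ≤ 2 * i := by
        rw [← hsum]
        calc _ ≤ ∑ x ∈ Finset.univ.filter (fun x => ¬ d x < 4 * M), d x := by
              rw [← smul_eq_mul]
              apply Finset.card_nsmul_le_sum
              intro x hx
              simpa using hx
          _ ≤ _ := Finset.sum_le_sum_of_subset (Finset.subset_univ _)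
      have h2 := Finset.card_filter_add_card_filter_not (s := (Finset.univ : Finset V)) (fun x => d x < 4 * M)
      rw [Finset.card_univ, hcard] at h2
      rw [hcard] at hi
      set t := (Finset.univ.filter (fun x => ¬ d x < 4 * M)).card
      have h3 : t ≤ 2 * k * D := by
        by_contra hlt
        push Not at hlt
        have : (2 * k * D) * (4 * M) < t * (4 * M) := Nat.mul_lt_mul_of_pos_right hlt (by omega)
        nlinarith
      rw [hSdef]
      linarith
    obtain ⟨u, hu, v, hv, huv, hgood⟩ := good_pair G g k D hk (by positivity) hcard S hS
      (fun u => eball_card G u (4 * M) (fun x => (hd x).trans (hdM x)) g) (hcol G hG)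
    have hne : u ≠ v := by
      rintro rfl
      exact huv (eball_of_walk G g .nil (by simp))
    simp only [hSdef, Finset.mem_filter, Finset.mem_univ, true_and] at hu hv
    refine ⟨G ⊔ SimpleGraph.edge u v, fun x => d x + ((if x = u then 1 else 0) + (if x = v then 1 else 0)),
      girth_add G g u v hG huv, ?_, ?_, ?_, ?_⟩
    · intro x
      beta_reduce
      refine le_trans (Finset.card_le_card (t := (Finset.univ.filter (fun y => G.Adj x y)) ∪
            ((if x = u then {v} else ∅) ∪ (if x = v then {u} else ∅))) ?_)
            ((Finset.card_union_le _ _).trans ?_)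
      · intro y hy
        simp only [Finset.mem_filter, Finset.mem_univ, true_and, SimpleGraph.sup_adj,
          SimpleGraph.edge_adj] at hy
        simp only [Finset.mem_union, Finset.mem_filter, Finset.mem_univ, true_and]
        rcases hy with h | ⟨⟨rfl, rfl⟩ | ⟨rfl, rfl⟩, _⟩
        · exact Or.inl h
        · simp
        · simp
      refine Nat.add_le_add (hd x) ((Finset.card_union_le _ _).trans (Nat.add_le_add ?_ ?_)) <;>
        split_ifs <;> simp
    · intro x
      have := hdM x
      by_cases h1 : x = u
      · subst h1; simp [hne]; omega
      · by_cases h2 : x = v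
        · subst h2; simp [h1]; omega
        · simp [h1, h2]; omega
    · rw [Finset.sum_add_distrib, Finset.sum_add_distrib, hsum]
      simp
      omega
    · have hsub : pcol (G ⊔ SimpleGraph.edge u v) k ⊆ (pcol G k).filter (fun c => ¬ c u = c v) := by
        intro c hc
        simp only [pcol, Finset.mem_filter, Finset.mem_univ, true_and] at hc ⊢
        refine ⟨fun a b hab => hc a b (Or.inl hab), hc u v (Or.inr ?_)⟩
        rw [SimpleGraph.edge_adj]; exact ⟨Or.inl ⟨rfl, rfl⟩, hne⟩
      have h1 := Finset.card_le_card hsub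
      have h2 := Finset.card_filter_add_card_filter_not (s := pcol G k) (fun c => c u = c v)
      set N' := (pcol (G ⊔ SimpleGraph.edge u v) k).card
      set N := (pcol G k).card
      set X := ((pcol G k).filter (fun c => c u = c v)).card
      set Y := ((pcol G k).filter (fun c => ¬ c u = c v)).card
      have hkR : (1 : ℝ) ≤ k := by exact_mod_cast hk
      have hkk : (0 : ℝ) < 8 * k ^ 2 := by positivity
      have h3 : (N : ℝ) * (1 / (8 * k ^ 2)) ≤ X := by
        rw [mul_one_div, div_le_iff₀ hkk]
        have : (N : ℝ) ≤ 8 * k ^ 2 * X := by exact_mod_cast hgood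
        linarith
      have h4 : (X : ℝ) + Y = N := by exact_mod_cast h2
      have h5 : (N' : ℝ) ≤ Y := by exact_mod_cast h1
      have h6 : (0 : ℝ) ≤ 1 - 1 / (8 * k ^ 2) := by
        rw [sub_nonneg, div_le_one hkk]; nlinarith
      calc (N' : ℝ) ≤ (1 - 1 / (8 * k ^ 2)) * N := by linarith
        _ ≤ (1 - 1 / (8 * k ^ 2)) * ((1 - 1 / (8 * k ^ 2)) ^ i * k ^ (Fintype.card V)) :=
            mul_le_mul_of_nonneg_left hN h6
        _ = _ := by ring

/-- Erdős: large girth and large chromatic number. -/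
theorem erdos_girth (g k : ℕ) : ∃ (n : ℕ) (H : SimpleGraph (Fin n)),
    (∀ a (w : H.Walk a a), w.IsCycle → g < w.length) ∧ ¬ H.Colorable k := by
  suffices hpos : ∀ k, 0 < k → ∃ (n : ℕ) (H : SimpleGraph (Fin n)),
      (∀ a (w : H.Walk a a), w.IsCycle → g < w.length) ∧ ¬ H.Colorable k by
    obtain ⟨n, H, h1, h2⟩ := hpos (k + 1) (by omega)
    exact ⟨n, H, h1, fun h => h2 (h.mono (by omega))⟩
  intro k hk
  by_contra hcon
  push Not at hcon
  have hkR : (1 : ℝ) ≤ k := by exact_mod_cast hk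
  have hkk : (0 : ℝ) < 8 * k ^ 2 := by positivity
  have h6 : (0 : ℝ) ≤ 1 - 1 / (8 * k ^ 2) := by
    rw [sub_nonneg, div_le_one hkk]; nlinarith
  have h7 : 1 - 1 / (8 * (k : ℝ) ^ 2) < 1 := by
    have : 0 < 1 / (8 * (k : ℝ) ^ 2) := by positivity
    linarith
  obtain ⟨M₀, hM₀⟩ := exists_pow_lt_of_lt_one (show (0 : ℝ) < 1 / k by positivity) h7
  set M := M₀ + 1 with hMdef
  have hM : (1 - 1 / (8 * (k : ℝ) ^ 2)) ^ M * k < 1 := by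
    have h8 : (1 - 1 / (8 * (k : ℝ) ^ 2)) ^ M ≤ (1 - 1 / (8 * (k : ℝ) ^ 2)) ^ M₀ :=
      pow_le_pow_of_le_one h6 h7.le (by omega)
    have := h8.trans_lt hM₀
    rwa [lt_div_iff₀ (by linarith)] at this
  set n := 4 * k * (4 * M + 1) ^ g with hn
  have hcol : ∀ G : SimpleGraph (Fin n), (∀ a (w : G.Walk a a), w.IsCycle → g < w.length) →
      0 < (pcol G k).card := by
    intro G hG
    obtain ⟨c⟩ := hcon n G hG
    rw [Finset.card_pos]
    exact ⟨c, by simp only [pcol, Finset.mem_filter, Finset.mem_univ, true_and]; exact fun a b h => c.valid h⟩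
  obtain ⟨G, d, hG, -, -, -, hN⟩ := erdos_iter g k M hk (V := Fin n) (by simp [hn]) (by omega) hcol
    (M * n) (by simp)
  have hp := hcol G hG
  have hn0 : n ≠ 0 := by positivity
  rw [Fintype.card_fin, pow_mul, ← mul_pow] at hN
  have : ((1 - 1 / (8 * (k : ℝ) ^ 2)) ^ M * k) ^ n < 1 :=
    pow_lt_one₀ (mul_nonneg (pow_nonneg h6 _) (by linarith)) hM hn0
  have h9 : (1 : ℝ) ≤ (pcol G k).card := by exact_mod_cast hp
  linarith

/-- `s` is coloured by `c` properly, with `n` colours. -/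
def SetCol {V : Type*} (G : SimpleGraph V) (n : ℕ) (s : Set V) : Prop :=
  ∃ c : V → Fin n, ∀ a ∈ s, ∀ b ∈ s, G.Adj a b → c a ≠ c b

theorem setCol_of_colorable {V : Type*} (G : SimpleGraph V) (n : ℕ) (s : Set V)
    (h : (G.induce s).Colorable n) : SetCol G (n + 1) s := by
  classical
  obtain ⟨c⟩ := h
  refine ⟨fun x => if hx : x ∈ s then (c ⟨x, hx⟩).castSucc else Fin.last n, ?_⟩
  intro a ha b hb hab
  simp only [ha, hb, dif_pos]
  intro h
  exact c.valid (show (G.induce s).Adj ⟨a, ha⟩ ⟨b, hb⟩ from hab) (Fin.castSucc_injective _ h)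

theorem colorable_of_setCol {V : Type*} (G : SimpleGraph V) (n : ℕ) (s : Set V)
    (h : SetCol G n s) : (G.induce s).Colorable n := by
  obtain ⟨c, hc⟩ := h
  exact ⟨SimpleGraph.Coloring.mk (fun x => c x.1) (fun {a b} hab => hc a.1 a.2 b.1 b.2 hab)⟩

theorem setCol_mono {V : Type*} (G : SimpleGraph V) (n : ℕ) {s t : Set V} (hst : s ⊆ t)
    (h : SetCol G n t) : SetCol G n s := by
  obtain ⟨c, hc⟩ := h
  exact ⟨c, fun a ha b hb => hc a (hst ha) b (hst hb)⟩

theorem setCol_union {V : Type*} (G : SimpleGraph V) (n m : ℕ) {s t : Set V}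
    (hs : SetCol G n s) (ht : SetCol G m t) : SetCol G (n + m) (s ∪ t) := by
  classical
  obtain ⟨c, hc⟩ := hs
  obtain ⟨d, hd⟩ := ht
  refine ⟨fun x => if x ∈ s then Fin.castAdd m (c x) else Fin.natAdd n (d x), ?_⟩
  intro a ha b hb hab h
  have h' := congrArg Fin.val h
  by_cases h1 : a ∈ s <;> by_cases h2 : b ∈ s
  · simp only [h1, h2, if_true, Fin.val_castAdd] at h'
    exact hc a h1 b h2 hab (Fin.ext h')
  · simp only [h1, h2, if_true, if_false, Fin.val_castAdd, Fin.val_natAdd] at h'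
    have := (c a).2; omega
  · simp only [h1, h2, if_true, if_false, Fin.val_castAdd, Fin.val_natAdd] at h'
    have := (c b).2; omega
  · simp only [h1, h2, if_false, Fin.val_natAdd] at h'
    exact hd a (ha.resolve_left h1) b (hb.resolve_left h2) hab (Fin.ext (by omega))

theorem chrom_top_iff {V : Type*} (G : SimpleGraph V) (s : Set V) :
    (G.induce s).chromaticNumber = ⊤ ↔ ∀ n, ¬ SetCol G n s := by
  constructor
  · intro h n hn
    exact SimpleGraph.chromaticNumber_ne_top_iff_exists.mpr ⟨n, colorable_of_setCol G n s hn⟩ h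
  · intro h
    by_contra hne
    obtain ⟨n, hn⟩ := SimpleGraph.chromaticNumber_ne_top_iff_exists.mp hne
    exact h _ (setCol_of_colorable G n s hn)

/-- An ultrafilter all of whose members have infinite chromatic number. -/
theorem exists_chrom_ultrafilter {V : Type*} (G : SimpleGraph V)
    (h : ∀ n, ¬ SetCol G n Set.univ) :
    ∃ U : Ultrafilter V, ∀ s ∈ U, ∀ n, ¬ SetCol G n s := by
  let F : Filter V :=
    { sets := {s | ∃ n, SetCol G n sᶜ}
      univ_sets := ⟨1, fun _ => 0, by simp⟩
      sets_of_superset := by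
        rintro s t ⟨n, hn⟩ hst
        exact ⟨n, setCol_mono G n (Set.compl_subset_compl.mpr hst) hn⟩
      inter_sets := by
        rintro s t ⟨n, hn⟩ ⟨m, hm⟩
        refine ⟨n + m, ?_⟩
        rw [Set.compl_inter]
        exact setCol_union G n m hn hm }
  have hF : F.NeBot := by
    refine ⟨fun hb => ?_⟩
    have : (∅ : Set V) ∈ F := by rw [hb]; exact Filter.mem_bot
    obtain ⟨n, hn⟩ := this
    rw [Set.compl_empty] at hn
    exact h n hn
  refine ⟨Ultrafilter.of F, fun s hs n hn => ?_⟩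
  have h1 : sᶜ ∈ F := ⟨n, by rwa [compl_compl]⟩
  have h2 : sᶜ ∈ Ultrafilter.of F := Ultrafilter.of_le F h1
  exact (Ultrafilter.compl_mem_iff_notMem.mp h2) hs

theorem induce_length {V : Type*} (G : SimpleGraph V) (T : Set V) {a b : V} (w : G.Walk a b)
    (h : ∀ x ∈ w.support, x ∈ T) : (w.induce T h).length = w.length := by
  have := congrArg List.length (SimpleGraph.Walk.support_induce (s := T) w h)
  rw [SimpleGraph.Walk.length_support, List.length_attachWith,
    SimpleGraph.Walk.length_support] at this
  omega

theorem induce_isCycle {V : Type*} (G : SimpleGraph V) (T : Set V) {a : V} (w : G.Walk a a)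
    (h : ∀ x ∈ w.support, x ∈ T) (hw : w.IsCycle) : (w.induce T h).IsCycle := by
  have h3 : ((w.induce T h).map (SimpleGraph.Embedding.induce T).toHom).IsCycle := by
    have := SimpleGraph.Walk.map_induce (s := T) w h
    exact this.symm ▸ hw
  exact (SimpleGraph.Walk.isCycle_map_iff_of_injective
    (f := (SimpleGraph.Embedding.induce (G := G) T).toHom) Subtype.val_injective).mp h3

theorem stmt_17 (g : ℕ) (hg : 3 ≤ g) {V : Type*} [Infinite V] (G : SimpleGraph V)
    (hchrom : G.chromaticNumber = ⊤) :
    ∃ s : Set V, (G.induce s).chromaticNumber = ⊤ ∧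
      ∃ (n : ℕ) (H : SimpleGraph (Fin n)), (g : ℕ∞) ≤ H.egirth ∧
        IsEmpty (H ↪g G.induce s) := by
  by_contra hcon
  have hall : ∀ s : Set V, (∀ n, ¬ SetCol G n s) → ∀ (n : ℕ) (H : SimpleGraph (Fin n)),
      (g : ℕ∞) ≤ H.egirth → Nonempty (H ↪g G.induce s) := by
    intro s hs n H hH
    by_contra hne
    exact hcon ⟨s, (chrom_top_iff G s).mpr hs, n, H, hH, not_nonempty_iff.mp hne⟩
  have huniv : ∀ n, ¬ SetCol G n Set.univ := by
    rintro n ⟨c, hc⟩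
    refine SimpleGraph.chromaticNumber_ne_top_iff_exists.mpr ⟨n, ?_⟩ hchrom
    exact ⟨SimpleGraph.Coloring.mk c (fun {a b} hab => hc a trivial b trivial hab)⟩
  obtain ⟨U, hU⟩ := exists_chrom_ultrafilter G huniv
  have hUne : ∀ s ∈ U, ∃ x, x ∈ s := fun s hs => Ultrafilter.nonempty_of_mem hs
  set A : Set V := {v | {w | G.Adj v w} ∈ U} with hA
  by_cases hAU : A ∈ U
  · -- an infinite clique
    obtain ⟨f, hf, hr⟩ := exists_seq_of_forall_finset_exists (fun v => v ∈ A) (fun v w => G.Adj v w)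
      (by
        intro s hs
        have h1 : (⋂ v ∈ s, {w | G.Adj v w}) ∈ U := by
          have := (Filter.biInter_finset_mem (f := (U : Filter V)) (s := fun v => {w | G.Adj v w}) s).mpr
            (fun v hv => hs v hv)
          exact this
        obtain ⟨y, hy1, hy2⟩ := hUne _ (Filter.inter_mem hAU h1)
        refine ⟨y, hy1, fun x hx => ?_⟩
        rw [Set.mem_iInter₂] at hy2
        exact hy2 x hx)
    have hr' : ∀ m n, m ≠ n → G.Adj (f m) (f n) := by
      intro m n hmn
      rcases lt_or_gt_of_ne hmn with h | h
      · exact hr m n h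
      · exact (hr n m h).symm
    have hs : ∀ n, ¬ SetCol G n (Set.range f) := by
      rintro n ⟨c, hc⟩
      have hinj : Function.Injective (fun i => c (f i)) := by
        intro i j hij
        by_contra hne
        exact hc (f i) ⟨i, rfl⟩ (f j) ⟨j, rfl⟩ (hr' i j hne) hij
      exact not_injective_infinite_finite _ hinj
    obtain ⟨e⟩ := hall _ hs 2 ⊥ (by simp)
    obtain ⟨i, hi⟩ := (e 0).2
    obtain ⟨j, hj⟩ := (e 1).2
    have hij : i ≠ j := by
      rintro rfl
      have : e 0 = e 1 := Subtype.ext (hi.symm.trans hj)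
      exact absurd (e.injective this) (by decide)
    have hadj : (G.induce (Set.range f)).Adj (e 0) (e 1) := by
      rw [SimpleGraph.induce_adj, ← hi, ← hj]
      exact hr' i j hij
    rw [e.map_adj_iff] at hadj
    exact hadj
  · have hBU : Aᶜ ∈ U := Ultrafilter.compl_mem_iff_notMem.mpr hAU
    -- a test graph with a cycle of length `ℓ ≥ g`
    obtain ⟨n₀, H₀, hH₀, hH₀c⟩ := erdos_girth g 2
    have hac : ¬ H₀.IsAcyclic := fun h => hH₀c h.colorable_two
    obtain ⟨a₀, w₀, hw₀, -⟩ := SimpleGraph.exists_egirth_eq_length.mpr hac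
    set ℓ := w₀.length with hℓ
    have hgℓ : g < ℓ := hH₀ a₀ w₀ hw₀
    -- the pieces
    obtain ⟨f, hf, hr⟩ := exists_seq_of_forall_finset_exists
      (fun q : ℕ × Finset V => (∀ x ∈ q.2, x ∈ Aᶜ) ∧ ¬ SetCol G q.1 (q.2 : Set V) ∧
        ∀ a (w : G.Walk a a), w.IsCycle → (∀ x ∈ w.support, x ∈ q.2) → ℓ < w.length)
      (fun q q' => q.1 < q'.1 ∧ ∀ x ∈ q.2, ∀ y ∈ q'.2, ¬ G.Adj x y)
      (by
        classical
        intro s hs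
        have h1 : (⋂ v ∈ s.biUnion Prod.snd, {w | G.Adj v w}ᶜ) ∈ U := by
          have := (Filter.biInter_finset_mem (f := (U : Filter V))
            (s := fun v => {w | G.Adj v w}ᶜ) (s.biUnion Prod.snd)).mpr (by
              intro v hv
              rw [Finset.mem_biUnion] at hv
              obtain ⟨q, hq, hv⟩ := hv
              exact Ultrafilter.compl_mem_iff_notMem.mpr ((hs q hq).1 v hv))
          exact this
        have h2 := Filter.inter_mem hBU h1
        set k := s.sup Prod.fst + 1 with hk
        obtain ⟨n, H, hH, hHc⟩ := erdos_girth ℓ k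
        obtain ⟨e⟩ := hall _ (hU _ h2) n H (by
          rw [SimpleGraph.le_egirth]
          intro a w hw
          have := hH a w hw
          exact_mod_cast (by omega : g ≤ w.length))
        have hmem : ∀ x ∈ Finset.univ.image (fun i => (e i).1), ∃ i, (e i).1 = x := by
          intro x hx; simpa using hx
        refine ⟨(k, Finset.univ.image (fun i => (e i).1)), ⟨?_, ?_, ?_⟩, ?_⟩
        · intro x hx
          obtain ⟨i, rfl⟩ := hmem x hx
          exact (e i).2.1
        · rintro ⟨c, hc⟩
          refine hHc ⟨SimpleGraph.Coloring.mk (fun i => c (e i).1) (fun {a b} hab => ?_)⟩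
          refine hc _ (by simp) _ (by simp) ?_
          exact e.map_adj_iff.mpr hab
        · intro a w hw hsupp
          have hne : Nonempty (Fin n) := (hmem a (hsupp a w.start_mem_support)).nonempty
          choose! φ hφ using hmem
          let T : Set V := {x | x ∈ Finset.univ.image (fun i => (e i).1)}
          let ψ : G.induce T →g H :=
            { toFun := fun x => φ x.1
              map_rel' := by
                rintro ⟨x, hx⟩ ⟨y, hy⟩ hxy
                rw [← e.map_adj_iff, SimpleGraph.induce_adj, hφ x hx, hφ y hy]
                exact hxy }
          have hψ : Function.Injective ψ := by
            rintro ⟨x, hx⟩ ⟨y, hy⟩ hxy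
            have hxy' : φ x = φ y := hxy
            apply Subtype.ext
            change x = y
            rw [← hφ x hx, ← hφ y hy, hxy']
          have hcyc : (w.induce T hsupp).IsCycle := induce_isCycle G T w hsupp hw
          have h4 := hH _ _ (hcyc.map hψ)
          have h5 : (w.induce T hsupp).length = w.length := induce_length G T w hsupp
          rw [SimpleGraph.Walk.length_map, h5] at h4
          exact h4
        · intro q hq
          refine ⟨?_, ?_⟩
          · have : q.1 ≤ s.sup Prod.fst := Finset.le_sup (f := Prod.fst) hq
            change q.1 < k
            omega
          · intro x hx y hy
            obtain ⟨i, rfl⟩ := hmem y hy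
            have h3 := (e i).2.2
            rw [Set.mem_iInter₂] at h3
            exact h3 x (Finset.mem_biUnion.mpr ⟨q, hq, hx⟩))
    have hmono : StrictMono (fun i => (f i).1) := fun i j hij => (hr i j hij).1
    set s : Set V := {x | ∃ i, x ∈ (f i).2} with hs
    have hsc : ∀ n, ¬ SetCol G n s := by
      rintro n ⟨c, hc⟩
      have hn : n ≤ (f n).1 := hmono.id_le n
      refine (hf n).2.1 ⟨fun x => Fin.castLE hn (c x), fun a ha b hb hab h => ?_⟩
      exact hc a ⟨n, ha⟩ b ⟨n, hb⟩ hab (Fin.castLE_injective hn h)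
    have hpiece : ∀ i j x y, x ∈ (f i).2 → y ∈ (f j).2 → G.Adj x y → i = j := by
      intro i j x y hx hy hxy
      rcases lt_trichotomy i j with h | h | h
      · exact absurd hxy ((hr i j h).2 x hx y hy)
      · exact h
      · exact absurd hxy.symm ((hr j i h).2 y hy x hx)
    have hwalk : ∀ (i : ℕ) (a b : V) (w : G.Walk a b), a ∈ (f i).2 → (∀ x ∈ w.support, x ∈ s) →
        ∀ x ∈ w.support, x ∈ (f i).2 := by
      intro i a b w
      induction w with
      | nil =>
        intro ha _ x hx
        rw [SimpleGraph.Walk.support_nil, List.mem_singleton] at hx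
        rwa [hx]
      | @cons a b c hab w ih =>
        intro ha hsup x hx
        rw [SimpleGraph.Walk.support_cons, List.mem_cons] at hx
        obtain ⟨j, hj⟩ := hsup b (by simp)
        have hij := hpiece i j a b ha hj hab
        subst hij
        rcases hx with rfl | hx
        · exact ha
        · exact ih hj (fun y hy => hsup y (by simp [hy])) x hx
    obtain ⟨e⟩ := hall s hsc n₀ H₀ (by
      rw [SimpleGraph.le_egirth]
      intro a w hw
      have := hH₀ a w hw
      exact_mod_cast (by omega : g ≤ w.length))
    let φ : H₀ →g G := (SimpleGraph.Embedding.induce s).toHom.comp e.toHom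
    have hφ : Function.Injective φ := Subtype.val_injective.comp e.injective
    have hcyc := hw₀.map hφ
    have hsup : ∀ x ∈ (w₀.map φ).support, x ∈ s := by
      intro x hx
      rw [SimpleGraph.Walk.support_map, List.mem_map] at hx
      obtain ⟨y, -, rfl⟩ := hx
      exact (e y).2
    obtain ⟨i, hi⟩ := hsup _ (w₀.map φ).start_mem_support
    have := (hf i).2.2 _ _ hcyc (hwalk i _ _ _ hi hsup)
    rw [SimpleGraph.Walk.length_map] at this
    omega
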